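/- Let A = (Q, Σ, δ) be an n-state weakly acyclic automaton such that there exists a word of rank r with respect to A. Then there exists a word of length at most n − r and of rank at most r with respect to A. -/

import Mathlib

/-- The extension of the transition function to words. -/
def deltaStar {Q A : Type*} (δ : Q → A → Q) (q : Q) (w : List A) : Q := w.foldl δ q

/-- A simple cycle: pairwise distinct states `q 0, …, q (k-1)` together with letters
mapping each state of the cycle to the next one (cyclically). -/
def IsSimpleCycle {Q A : Type*} (δ : Q → A → Q) (k : ℕ) (q : Fin k → Q) : Prop :=
  0 < k ∧ Function.Injective q ∧
    ∃ x : Fin k → A, ∀ i : Fin k, δ (q i) (x i) = q ⟨(i.val + 1) % k, Nat.mod_lt _ i.pos⟩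

/-- An automaton is weakly acyclic if all its simple cycles are self-loops. -/
def WeaklyAcyclic {Q A : Type*} (δ : Q → A → Q) : Prop :=
  ∀ (k : ℕ) (q : Fin k → Q), IsSimpleCycle δ k q → k = 1

/-- A sink state is fixed by every letter. -/
def IsSink {Q A : Type*} (δ : Q → A → Q) (q : Q) : Prop := ∀ x : A, δ q x = q

/-- The word `w` synchronizes the set `S` of states. -/
def SyncsSet {Q A : Type*} (δ : Q → A → Q) (S : Finset Q) (w : List A) : Prop :=
  ∃ q : Q, ∀ s ∈ S, deltaStar δ s w = q

/-- A set of states is synchronizing if some word synchronizes it. -/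
def IsSyncSet {Q A : Type*} (δ : Q → A → Q) (S : Finset Q) : Prop :=
  ∃ w : List A, SyncsSet δ S w

/-- The rank of a word with respect to an automaton: the size of the image of the
state set under the word. -/
def wordRank {Q A : Type*} [Fintype Q] [DecidableEq Q] (δ : Q → A → Q) (w : List A) : ℕ :=
  (Finset.univ.image fun q => deltaStar δ q w).card

/-- The rank of an automaton: the minimum rank of a word with respect to it. -/
noncomputable def autRank {Q A : Type*} [Fintype Q] [DecidableEq Q] (δ : Q → A → Q) : ℕ :=
  sInf {r | ∃ w : List A, wordRank δ w = r}

/-- The rank of a word with respect to a subset of states. -/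
def subsetWordRank {Q A : Type*} [DecidableEq Q] (δ : Q → A → Q) (S : Finset Q)
    (w : List A) : ℕ :=
  (S.image fun q => deltaStar δ q w).card

/-- The rank of a subset of states: the minimum rank of a word with respect to it. -/
noncomputable def subsetRank {Q A : Type*} [DecidableEq Q] (δ : Q → A → Q) (S : Finset Q) : ℕ :=
  sInf {r | ∃ w : List A, subsetWordRank δ S w = r}

/-- `w^j`: the word obtained by `j` concatenations of `w`. -/
def wordPow {A : Type*} (w : List A) (j : ℕ) : List A := (List.replicate j w).flatten

/-- A fixed-point-free choice of predecessor on a nonempty set yields a nontrivial cycle. -/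
theorem no_pred_map {Q A : Type*} [Fintype Q] (δ : Q → A → Q) (hwa : WeaklyAcyclic δ)
    (P : Set Q) (a : P) (g : P → P) (hne : ∀ q, g q ≠ q)
    (hg : ∀ q : P, ∃ x, δ (g q) x = q) : False := by
  classical
  have hper : ∃ y : P, y ∈ Function.periodicPts g := by
    obtain ⟨m, n, hmn, h⟩ := Finite.exists_ne_map_eq_of_infinite (fun m : ℕ => g^[m] a)
    have key : ∀ m n : ℕ, m < n → g^[m] a = g^[n] a → ∃ y : P, y ∈ Function.periodicPts g := by
      intro m n hlt h
      refine ⟨g^[m] a, n - m, by omega, ?_⟩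
      show g^[n - m] (g^[m] a) = g^[m] a
      rw [← Function.iterate_add_apply, h]
      congr 2
      omega
    rcases lt_or_gt_of_ne hmn with h1 | h1
    · exact key m n h1 h
    · exact key n m h1 h.symm
  obtain ⟨y, hy⟩ := hper
  have hpos := Function.minimalPeriod_pos_of_mem_periodicPts hy
  have hinj := Function.iterate_injOn_Iio_minimalPeriod (f := g) (x := y)
  have hfix : g^[Function.minimalPeriod g y] y = y := Function.iterate_minimalPeriod
  generalize Function.minimalPeriod g y = k at *
  have hk : k = 1 := by
    apply hwa k (fun i => (g^[k - 1 - i.val] y : P))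
    refine ⟨hpos, ?_, ?_⟩
    · intro i j hij
      have h1 := hinj (show k - 1 - i.val ∈ Set.Iio k by simp; omega)
        (show k - 1 - j.val ∈ Set.Iio k by simp; omega) (Subtype.ext hij)
      ext
      omega
    · rw [← Classical.skolem (p := fun (i : Fin k) x => δ (g^[k - 1 - i.val] y : P) x =
        (g^[k - 1 - (i.val + 1) % k] y : P))]
      intro i
      by_cases hi : i.val + 1 < k
      · obtain ⟨x, hx⟩ := hg (g^[k - 1 - (i.val + 1)] y)
        refine ⟨x, ?_⟩
        simp only [Nat.mod_eq_of_lt hi]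
        rw [← hx, ← Function.iterate_succ_apply' g]
        congr 4
        omega
      · have hi2 : i.val + 1 = k := by omega
        obtain ⟨x, hx⟩ := hg (g^[k - 1] y)
        refine ⟨x, ?_⟩
        simp only [hi2, Nat.mod_self, Nat.sub_zero]
        rw [← hx, ← Function.iterate_succ_apply' g]
        have e1 : (k - 1).succ = k := by omega
        have e2 : k - 1 - i.val = 0 := by omega
        rw [e1, e2, hfix]
        rfl
  subst hk
  exact hne y hfix

theorem exists_source {Q A : Type*} [Fintype Q] (δ : Q → A → Q) (hwa : WeaklyAcyclic δ)
    (P : Set Q) (hP : P.Nonempty) : ∃ q ∈ P, ∀ p ∈ P, ∀ x, δ p x = q → p = q := by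
  by_contra! h
  obtain ⟨a, ha⟩ := hP
  choose g hg x hx hne using h
  exact no_pred_map δ hwa P ⟨a, ha⟩ (fun q => ⟨g q q.2, hg q q.2⟩)
    (fun q hq => hne q q.2 (congrArg Subtype.val hq)) (fun q => ⟨x q q.2, hx q q.2⟩)

theorem exists_avoid {Q A : Type*} [Fintype Q] [DecidableEq Q] (δ : Q → A → Q)
    (hwa : WeaklyAcyclic δ) (N : Finset Q) (hN : ∀ q, q ∈ N ↔ ¬ IsSink δ q) (k : ℕ)
    (hk : k ≤ N.card) : ∃ (w : List A) (D : Finset Q), w.length = k ∧ D.card = k ∧ D ⊆ N ∧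
      (∀ p x, δ p x ∈ D → p ∈ D) ∧ ∀ p, deltaStar δ p w ∉ D := by
  induction k with
  | zero => exact ⟨[], ∅, by simp⟩
  | succ k ih =>
    obtain ⟨w, D, hw, hD, hDN, hcl, hav⟩ := ih (by omega)
    have hne : ((N \ D : Finset Q) : Set Q).Nonempty := by
      rw [Finset.coe_nonempty, ← Finset.card_pos, Finset.card_sdiff_of_subset hDN]
      omega
    obtain ⟨q, hq, hsrc⟩ := exists_source δ hwa _ hne
    simp only [Finset.coe_sdiff, Set.mem_sdiff, Finset.mem_coe] at hq hsrc
    have hq1 := (hN q).1 hq.1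
    unfold IsSink at hq1
    push Not at hq1
    obtain ⟨x, hx⟩ := hq1
    have hpred : ∀ p y, p ∉ D → δ p y = q → p = q := by
      intro p y hp hpy
      by_cases hs : p ∈ N
      · exact hsrc p ⟨hs, hp⟩ y hpy
      · rw [hN, not_not] at hs
        rw [← hpy, hs y]
    refine ⟨w ++ [x], insert q D, by simp [hw], by rw [Finset.card_insert_of_notMem hq.2, hD],
      Finset.insert_subset hq.1 hDN, ?_, ?_⟩
    · intro p y h
      rw [Finset.mem_insert] at h ⊢
      by_cases hp : p ∈ D
      · exact Or.inr hp
      · rcases h with h | h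
        · exact Or.inl (hpred p y hp h)
        · exact Or.inr (hcl p y h)
    · intro p h
      have e : deltaStar δ p (w ++ [x]) = δ (deltaStar δ p w) x := by simp [deltaStar]
      rw [e, Finset.mem_insert] at h
      rcases h with h | h
      · have := hpred _ x (hav p) h
        rw [this] at h
        exact hx h
      · exact hav p (hcl _ _ h)

/-- If a weakly acyclic `n`-state automaton admits a word of rank `r`, then it admits a
word of length at most `n - r` and rank at most `r`. -/
theorem stmt3 {Q A : Type*} [Fintype Q] [DecidableEq Q] [Fintype A] (δ : Q → A → Q)
    (n r : ℕ) (hn : Fintype.card Q = n) (hwa : WeaklyAcyclic δ)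
    (hw : ∃ w : List A, wordRank δ w = r) :
    ∃ w : List A, w.length ≤ n - r ∧ wordRank δ w ≤ r := by
  classical
  obtain ⟨w, hw⟩ := hw
  let N : Finset Q := Finset.univ.filter fun q => ¬ IsSink δ q
  have hN : ∀ q, q ∈ N ↔ ¬ IsSink δ q := by simp [N]
  have hfix : ∀ (q : Q), IsSink δ q → ∀ w : List A, deltaStar δ q w = q := by
    intro q hq w
    induction w with
    | nil => rfl
    | cons a t ih =>
      have : deltaStar δ q (a :: t) = deltaStar δ (δ q a) t := rfl
      rw [this, hq a, ih]
  have hs : Nᶜ.card ≤ r := by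
    rw [← hw]
    apply Finset.card_le_card
    intro q hq
    rw [Finset.mem_compl, hN, not_not] at hq
    exact Finset.mem_image.2 ⟨q, Finset.mem_univ _, hfix q hq w⟩
  have hr : r ≤ n := by
    rw [← hw, ← hn]
    exact Finset.card_le_univ _
  rw [Finset.card_compl] at hs
  obtain ⟨v, D, hv, hD, -, -, hav⟩ := exists_avoid δ hwa N hN (n - r) (by omega)
  refine ⟨v, hv.le, ?_⟩
  have hle : wordRank δ v ≤ Dᶜ.card := by
    apply Finset.card_le_card
    intro q hq
    obtain ⟨p, -, rfl⟩ := Finset.mem_image.1 hq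
    exact Finset.mem_compl.2 (hav p)
  rw [Finset.card_compl] at hle
  omega
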